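/- Let ρ < α, let u ∈ W_Γ, and suppose σ ↦ E_σ is twice differentiable in operator norm at ρ (first derivative existing near ρ). Then the second derivative at ρ of the function σ ↦ s_σ(u,u) = a_σ(E_σu, E_σu) satisfies s''(u,u) ≥ −(2/(α − ρ))·‖E_ρu‖². Equivalently, −⟨S''_ρ u, u⟩ ≤ (2/(α − ρ))·‖E_ρu‖². -/

import Mathlib

open scoped RealInnerProductSpace

open Filter in
/-- If the increments of `f` at `x` lie in a closed subspace, so does the derivative. -/
theorem HasDerivAt.mem_of_eventually_sub_mem {V : Type*} [NormedAddCommGroup V]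
    [NormedSpace ℝ V] {K : Submodule ℝ V} (hK : IsClosed (K : Set V)) {f : ℝ → V} {f' : V}
    {x : ℝ} (hf : HasDerivAt f f' x) (hmem : ∀ᶠ t in nhds x, f t - f x ∈ K) : f' ∈ K := by
  refine hK.mem_of_tendsto (hasDerivAt_iff_tendsto_slope.1 hf) ?_
  filter_upwards [nhdsWithin_le_nhds hmem] with t ht
  exact K.smul_mem _ ht

/-- The derivative of a shifted symmetric quadratic form along a differentiable curve. -/
theorem HasDerivAt.shifted_quadratic {V : Type*} [NormedAddCommGroup V]
    [InnerProductSpace ℝ V] (a : V →L[ℝ] V →L[ℝ] ℝ) (hsymm : ∀ v w : V, a v w = a w v)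
    {e : ℝ → V} {e' : V} {σ : ℝ} (he : HasDerivAt e e' σ) :
    HasDerivAt (fun t => a (e t) (e t) - t * ⟪e t, e t⟫)
      (2 * (a (e σ) e' - σ * ⟪e σ, e'⟫) - ‖e σ‖ ^ 2) σ := by
  have h := ((a.hasFDerivAt.comp_hasDerivAt σ he).clm_apply he).sub
    ((hasDerivAt_id σ).mul (he.inner ℝ he))
  refine h.congr_deriv ?_
  simp only [Function.comp_apply, id, hsymm e' (e σ), real_inner_comm (e σ) e',
    real_inner_self_eq_norm_sq]
  ring

/-- Let ρ < α, u ∈ W_Γ, and suppose σ ↦ E_σ is twice differentiable in operator norm at ρ.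
Then the second derivative at ρ of σ ↦ s_σ(u,u) = a_σ(E_σu, E_σu) satisfies
s''(u,u) ≥ −(2/(α − ρ))·‖E_ρu‖². -/
theorem stmt13
    {V : Type*} [NormedAddCommGroup V] [InnerProductSpace ℝ V] [CompleteSpace V]
    {WΓ : Type*} [NormedAddCommGroup WΓ] [InnerProductSpace ℝ WΓ] [CompleteSpace WΓ]
    (a : V →L[ℝ] V →L[ℝ] ℝ)
    (hsymm : ∀ v w : V, a v w = a w v)
    (VI : Submodule ℝ V) (hVI : IsClosed (VI : Set V))
    (α : ℝ) (hα : 0 < α)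
    (hcoer : ∀ w ∈ VI, a w w ≥ α * ‖w‖ ^ 2)
    (E : ℝ → (WΓ →L[ℝ] V))
    (hext : ∀ σ, σ < α → ∀ u : WΓ, ∀ w ∈ VI, a (E σ u) w - σ * ⟪E σ u, w⟫ = 0)
    (hdiffVI : ∀ σ₁ σ₂, σ₁ < α → σ₂ < α → ∀ u : WΓ, E σ₁ u - E σ₂ u ∈ VI)
    (ρ : ℝ) (hρ : ρ < α)
    (E' : ℝ → (WΓ →L[ℝ] V)) (E'' : WΓ →L[ℝ] V)
    (hE' : ∀ᶠ σ in nhds ρ, HasDerivAt E (E' σ) σ)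
    (hE'' : HasDerivAt E' E'' ρ)
    (u : WΓ) :
    deriv (deriv (fun σ => a (E σ u) (E σ u) - σ * ⟪E σ u, E σ u⟫)) ρ
      ≥ -(2 / (α - ρ)) * ‖E ρ u‖ ^ 2 := by
  have hE'u : ∀ᶠ σ in nhds ρ, HasDerivAt (fun t => E t u) (E' σ u) σ :=
    hE'.mono fun σ h => by simpa using h.clm_apply (hasDerivAt_const σ u)
  have hlt : ∀ᶠ σ in nhds ρ, σ < α := eventually_lt_nhds hρ
  have hmem : ∀ {σ}, σ < α → HasDerivAt (fun t => E t u) (E' σ u) σ → E' σ u ∈ VI :=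
    fun hσ h => h.mem_of_eventually_sub_mem hVI
      ((eventually_lt_nhds hσ).mono fun t ht => hdiffVI t _ ht hσ u)
  have hderiv : deriv (fun σ => a (E σ u) (E σ u) - σ * ⟪E σ u, E σ u⟫) =ᶠ[nhds ρ]
      fun σ => -‖E σ u‖ ^ 2 := by
    filter_upwards [hE'u, hlt] with σ h hσ
    rw [(h.shifted_quadratic a hsymm).deriv, hext σ hσ u _ (hmem hσ h)]
    ring
  have he := hE'u.self_of_nhds
  have hw := hmem hρ he
  have hres : a (E' ρ u) (E' ρ u) - ρ * ‖E' ρ u‖ ^ 2 = ⟪E ρ u, E' ρ u⟫ := by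
    have hd := ((a.hasFDerivAt.comp_hasDerivAt ρ he).clm_apply
      (hasDerivAt_const ρ (E' ρ u))).sub
      ((hasDerivAt_id ρ).mul (he.inner ℝ (hasDerivAt_const ρ (E' ρ u))))
    have hzero := hd.unique ((hasDerivAt_const ρ (0 : ℝ)).congr_of_eventuallyEq
      (hlt.mono fun σ hσ => hext σ hσ u _ hw))
    simp only [Function.comp_apply, id, map_zero, inner_zero_right,
      real_inner_self_eq_norm_sq] at hzero
    linarith
  rw [hderiv.deriv_eq, he.norm_sq.fun_neg.deriv]
  have hpos : 0 < α - ρ := sub_pos.2 hρ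
  have hbound : ⟪E ρ u, E' ρ u⟫ * (α - ρ) ≤ ‖E ρ u‖ ^ 2 := by
    have hcs := real_inner_le_norm (E ρ u) (E' ρ u)
    have hc := hcoer _ hw
    nlinarith [sq_nonneg (‖E ρ u‖ - (α - ρ) * ‖E' ρ u‖)]
  have hdiv := (le_div_iff₀ hpos).2 hbound
  have hrew : -(2 / (α - ρ)) * ‖E ρ u‖ ^ 2 = -(2 * (‖E ρ u‖ ^ 2 / (α - ρ))) := by ring
  rw [ge_iff_le, hrew]
  linarith
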